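/- arXiv:2508.13407 — 3 statements merged into one kernel-verified Lean document; each statement's English description precedes it below -/
import Mathlib

section
/- Time-shifted infeasibility (Theorem 1, single shift). Suppose the binary sequence ν̂ = (ν̂[0],…,ν̂[K−1]) is such that the pair (μ, ν̂) is trajectory-infeasible for every binary sequence μ ∈ ({0,1}^{n_μ})^K. Assume in addition: (1) the initial state is stationary, x₀ = A x₀; (2) there exists u ∈ ℝ^{n_u} with C x₀ + D u + H_ν ν̂[0] ≤ h componentwise; (3) for every index i ∈ {1,…,n_u}, the i-th column of B is zero or the i-th column of D is zero. Then for every vector w ∈ {0,1}^{n_ν}, the time-shifted sequence ˢν̂ = (ν̂[1], ν̂[2], …, ν̂[K−1], w) also makes the pair (μ, ˢν̂) trajectory-infeasible for every binary sequence μ ∈ ({0,1}^{n_μ})^K. -/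
open Matrix

/-- A real vector is binary if every entry is `0` or `1`. -/
def IsBinaryVec {n : ℕ} (v : Fin n → ℝ) : Prop := ∀ i, v i = 0 ∨ v i = 1

/-- The pair `(μ, ν)` of binary sequences is trajectory-feasible: there exist states
`x[0..K]` and inputs `u[0..K-1]` with `x[0] = x₀`, the linear dynamics
`x[k+1] = A x[k] + B u[k] + G_μ μ[k]`, and the componentwise inequality constraints
`C x[k] + D u[k] + H_μ μ[k] + H_ν ν[k] ≤ h` for all `0 ≤ k ≤ K-1`. -/
def TrajFeasible (K n_x n_u nμ nν n_c : ℕ)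
    (A : Matrix (Fin n_x) (Fin n_x) ℝ) (B : Matrix (Fin n_x) (Fin n_u) ℝ)
    (Gμ : Matrix (Fin n_x) (Fin nμ) ℝ)
    (C : Matrix (Fin n_c) (Fin n_x) ℝ) (D : Matrix (Fin n_c) (Fin n_u) ℝ)
    (Hμ : Matrix (Fin n_c) (Fin nμ) ℝ) (Hν : Matrix (Fin n_c) (Fin nν) ℝ)
    (h : Fin n_c → ℝ) (x0 : Fin n_x → ℝ)
    (μ : Fin K → Fin nμ → ℝ) (ν : Fin K → Fin nν → ℝ) : Prop :=
  ∃ (x : Fin (K + 1) → Fin n_x → ℝ) (u : Fin K → Fin n_u → ℝ),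
    x 0 = x0 ∧
    (∀ k : Fin K, x k.succ = A.mulVec (x k.castSucc) + B.mulVec (u k) + Gμ.mulVec (μ k)) ∧
    (∀ k : Fin K, ∀ i,
      (C.mulVec (x k.castSucc) + D.mulVec (u k) + Hμ.mulVec (μ k) + Hν.mulVec (ν k)) i ≤ h i)

/-- If every column of `B` or the corresponding column of `D` vanishes, then any input can be
replaced by one that has the same image under `D` and lies in the kernel of `B`. -/
theorem exists_mulVec_eq_zero_and_mulVec_eq {R l m n : Type*} [NonUnitalNonAssocSemiring R]
    [Fintype n] (B : Matrix l n R) (D : Matrix m n R)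
    (hdisj : ∀ j, (∀ i, B i j = 0) ∨ (∀ i, D i j = 0)) (u : n → R) :
    ∃ v : n → R, B.mulVec v = 0 ∧ D.mulVec v = D.mulVec u := by
  classical
  refine ⟨fun j => if ∀ i, D i j = 0 then 0 else u j, ?_, ?_⟩
  · ext i
    refine Finset.sum_eq_zero fun j _ => ?_
    rcases hdisj j with hB | hD
    · simp [hB i]
    · simp [hD]
  · ext i
    refine Finset.sum_congr rfl fun j _ => ?_
    by_cases hD : ∀ i, D i j = 0
    · simp [hD]
    · simp only [if_neg hD]

/-- **Time-shifted infeasibility (single shift).** If `(μ, ν̂)` is trajectory-infeasible for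
every binary `μ`, the initial state is stationary (`A x₀ = x₀`), the inequality constraint is
satisfiable at `k = 0` for `ν̂[0]`, and the columns of `B` and `D` have disjoint supports, then
for any binary `w` the shifted sequence `(ν̂[1], …, ν̂[K-1], w)` is also trajectory-infeasible
for every binary `μ`. -/
theorem time_shifted_infeasibility
    (K n_x n_u nμ nν n_c : ℕ) (hK : 0 < K)
    (A : Matrix (Fin n_x) (Fin n_x) ℝ) (B : Matrix (Fin n_x) (Fin n_u) ℝ)
    (Gμ : Matrix (Fin n_x) (Fin nμ) ℝ)
    (C : Matrix (Fin n_c) (Fin n_x) ℝ) (D : Matrix (Fin n_c) (Fin n_u) ℝ)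
    (Hμ : Matrix (Fin n_c) (Fin nμ) ℝ) (Hν : Matrix (Fin n_c) (Fin nν) ℝ)
    (h : Fin n_c → ℝ) (x0 : Fin n_x → ℝ)
    (νhat : Fin K → Fin nν → ℝ) (hνbin : ∀ k, IsBinaryVec (νhat k))
    (hinf : ∀ μ : Fin K → Fin nμ → ℝ, (∀ k, IsBinaryVec (μ k)) →
      ¬ TrajFeasible K n_x n_u nμ nν n_c A B Gμ C D Hμ Hν h x0 μ νhat)
    (hstat : A.mulVec x0 = x0)
    (hsat : ∃ u : Fin n_u → ℝ,
      ∀ i, (C.mulVec x0 + D.mulVec u + Hν.mulVec (νhat ⟨0, hK⟩)) i ≤ h i)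
    (hdisj : ∀ j : Fin n_u, (∀ i, B i j = 0) ∨ (∀ i, D i j = 0))
    (w : Fin nν → ℝ) (hw : IsBinaryVec w) :
    ∀ μ : Fin K → Fin nμ → ℝ, (∀ k, IsBinaryVec (μ k)) →
      ¬ TrajFeasible K n_x n_u nμ nν n_c A B Gμ C D Hμ Hν h x0 μ
        (fun k => if hk : (k : ℕ) + 1 < K then νhat ⟨(k : ℕ) + 1, hk⟩ else w) := by
  rintro μ hμ ⟨x, u, hx0, hdyn, hcon⟩
  obtain ⟨K, rfl⟩ := Nat.exists_eq_succ_of_ne_zero hK.ne'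
  obtain ⟨u₀, hu₀⟩ := hsat
  obtain ⟨v, hBv, hDv⟩ := exists_mulVec_eq_zero_and_mulVec_eq B D hdisj u₀
  let μ' : Fin (K + 1) → Fin nμ → ℝ := Fin.cons 0 fun k : Fin K => μ k.castSucc
  let x' : Fin (K + 2) → Fin n_x → ℝ := Fin.cons x0 fun k : Fin (K + 1) => x k.castSucc
  let u' : Fin (K + 1) → Fin n_u → ℝ := Fin.cons v fun k : Fin K => u k.castSucc
  refine hinf μ' (fun k => ?_) ⟨x', u', rfl, fun k => ?_, fun k i => ?_⟩
  · cases k using Fin.cases with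
    | zero => exact fun _ => Or.inl rfl
    | succ k => exact hμ k.castSucc
  · cases k using Fin.cases with
    | zero =>
      change x 0 = A.mulVec x0 + B.mulVec v + Gμ.mulVec 0
      simp [hx0, hstat, hBv]
    | succ k => exact hdyn k.castSucc
  · cases k using Fin.cases with
    | zero =>
      change (C.mulVec x0 + D.mulVec v + Hμ.mulVec 0 + Hν.mulVec (νhat 0)) i ≤ h i
      simpa [hDv] using hu₀ i
    | succ k =>
      have hk := hcon k.castSucc i
      beta_reduce at hk
      rw [dif_pos (show (k.castSucc : ℕ) + 1 < K + 1 by simp)] at hk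
      exact hk
end

section
/- Certificate normalization: making λ[0] vanish. Fix binary sequences μ ∈ ({0,1}^{n_μ})^K with μ[0] = 0 and ν ∈ ({0,1}^{n_ν})^K, and suppose (λ, π) is a Farkas certificate for (μ, ν). Assume: (2) there exists u ∈ ℝ^{n_u} with C x₀ + D u + H_ν ν[0] ≤ h componentwise; (3) for every index i ∈ {1,…,n_u}, the i-th column of B is zero or the i-th column of D is zero. Define λ'[0] = 0 and λ'[k] = λ[k] for 1 ≤ k ≤ K−1, and π'[0] = π[0] + Cᵀλ[0] and π'[k] = π[k] for 1 ≤ k ≤ K. Then (λ', π') is also a Farkas certificate for (μ, ν), and it satisfies λ'[0] = 0. -/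
open Matrix

/-- A Farkas certificate `(λ, π)` of infeasibility for the pair `(μ, ν)`:
(a) `λ[k] ≥ 0`, (b) `Aᵀπ[k+1] = π[k] + Cᵀλ[k]`, (c) `Bᵀπ[k+1] = Dᵀλ[k]`,
(e) `π[K] = 0`, and (d) the strict inequality
`x₀ᵀπ[0] + Σ (G_μ μ[k])ᵀπ[k+1] + Σ (h − H_μ μ[k] − H_ν ν[k])ᵀλ[k] < 0`. -/
def FarkasCert (K n_x n_u nμ nν n_c : ℕ)
    (A : Matrix (Fin n_x) (Fin n_x) ℝ) (B : Matrix (Fin n_x) (Fin n_u) ℝ)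
    (Gμ : Matrix (Fin n_x) (Fin nμ) ℝ)
    (C : Matrix (Fin n_c) (Fin n_x) ℝ) (D : Matrix (Fin n_c) (Fin n_u) ℝ)
    (Hμ : Matrix (Fin n_c) (Fin nμ) ℝ) (Hν : Matrix (Fin n_c) (Fin nν) ℝ)
    (h : Fin n_c → ℝ) (x0 : Fin n_x → ℝ)
    (μ : Fin K → Fin nμ → ℝ) (ν : Fin K → Fin nν → ℝ)
    (lam : Fin K → Fin n_c → ℝ) (pi : Fin (K + 1) → Fin n_x → ℝ) : Prop :=
  (∀ k : Fin K, ∀ i, 0 ≤ lam k i) ∧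
  (∀ k : Fin K, Aᵀ.mulVec (pi k.succ) = pi k.castSucc + Cᵀ.mulVec (lam k)) ∧
  (∀ k : Fin K, Bᵀ.mulVec (pi k.succ) = Dᵀ.mulVec (lam k)) ∧
  pi (Fin.last K) = 0 ∧
  x0 ⬝ᵥ pi 0 + (∑ k : Fin K, Gμ.mulVec (μ k) ⬝ᵥ pi k.succ)
    + (∑ k : Fin K, (h - Hμ.mulVec (μ k) - Hν.mulVec (ν k)) ⬝ᵥ lam k) < 0

/-- If each column of `B` or the corresponding column of `D` vanishes, then `Bᵀ x = Dᵀ y` forces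
both sides to vanish. -/
theorem mulVec_transpose_eq_zero_of_disjoint_columns {R m n p : Type*}
    [NonUnitalNonAssocSemiring R] [Fintype m] [Fintype p]
    {B : Matrix m n R} {D : Matrix p n R}
    (hdisj : ∀ j, (∀ i, B i j = 0) ∨ (∀ i, D i j = 0)) {x : m → R} {y : p → R}
    (hxy : Bᵀ *ᵥ x = Dᵀ *ᵥ y) : Dᵀ *ᵥ y = 0 := by
  funext j
  rcases hdisj j with hB | hD
  · rw [← hxy]
    simp [mulVec, dotProduct, hB]
  · simp [mulVec, dotProduct, hD]

/-- Weak duality: a nonnegative multiplier `l` with `Dᵀ l = 0` bounds `xᵀ Cᵀ l` by the slack of the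
constraint `C x + D u + w ≤ h`. -/
theorem dotProduct_transpose_mulVec_le {R m n p : Type*} [CommRing R] [LinearOrder R]
    [IsStrictOrderedRing R] [Fintype m] [Fintype n] [Fintype p]
    {C : Matrix m n R} {D : Matrix m p R} {x : n → R} {u : p → R} {w h l : m → R}
    (hle : ∀ i, (C *ᵥ x + D *ᵥ u + w) i ≤ h i) (hl : ∀ i, 0 ≤ l i) (hD : Dᵀ *ᵥ l = 0) :
    x ⬝ᵥ Cᵀ *ᵥ l ≤ (h - w) ⬝ᵥ l := by
  have hdual : (C *ᵥ x + D *ᵥ u + w) ⬝ᵥ l ≤ h ⬝ᵥ l :=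
    dotProduct_le_dotProduct_of_nonneg_right hle hl
  have hC : C *ᵥ x ⬝ᵥ l = x ⬝ᵥ Cᵀ *ᵥ l := by
    rw [dotProduct_mulVec, vecMul_transpose]
  have hu : D *ᵥ u ⬝ᵥ l = 0 := by
    rw [← vecMul_transpose, ← dotProduct_mulVec, hD, dotProduct_zero]
  rw [add_dotProduct, add_dotProduct, hC, hu] at hdual
  rw [sub_dotProduct]
  linarith

/-- **Certificate normalization: making `λ[0]` vanish.** Given a Farkas certificate
`(λ, π)` for `(μ, ν)` with `μ[0] = 0`, if the inequality constraint is satisfiable at the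
initial state for `ν[0]` and the columns of `B` and `D` have disjoint supports, then the
modified pair `(λ', π')` with `λ'[0] = 0`, `λ'[k] = λ[k]` for `k ≥ 1`,
`π'[0] = π[0] + Cᵀλ[0]`, `π'[k] = π[k]` for `k ≥ 1`, is also a Farkas certificate for
`(μ, ν)`, and it satisfies `λ'[0] = 0`. -/
theorem farkas_certificate_normalization
    (K n_x n_u nμ nν n_c : ℕ) (hK : 0 < K)
    (A : Matrix (Fin n_x) (Fin n_x) ℝ) (B : Matrix (Fin n_x) (Fin n_u) ℝ)
    (Gμ : Matrix (Fin n_x) (Fin nμ) ℝ)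
    (C : Matrix (Fin n_c) (Fin n_x) ℝ) (D : Matrix (Fin n_c) (Fin n_u) ℝ)
    (Hμ : Matrix (Fin n_c) (Fin nμ) ℝ) (Hν : Matrix (Fin n_c) (Fin nν) ℝ)
    (h : Fin n_c → ℝ) (x0 : Fin n_x → ℝ)
    (μ : Fin K → Fin nμ → ℝ) (hμbin : ∀ k, IsBinaryVec (μ k))
    (hμ0 : μ ⟨0, hK⟩ = 0)
    (ν : Fin K → Fin nν → ℝ) (hνbin : ∀ k, IsBinaryVec (ν k))
    (lam : Fin K → Fin n_c → ℝ) (pi : Fin (K + 1) → Fin n_x → ℝ)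
    (hcert : FarkasCert K n_x n_u nμ nν n_c A B Gμ C D Hμ Hν h x0 μ ν lam pi)
    (hsat : ∃ u : Fin n_u → ℝ,
      ∀ i, (C.mulVec x0 + D.mulVec u + Hν.mulVec (ν ⟨0, hK⟩)) i ≤ h i)
    (hdisj : ∀ j : Fin n_u, (∀ i, B i j = 0) ∨ (∀ i, D i j = 0)) :
    FarkasCert K n_x n_u nμ nν n_c A B Gμ C D Hμ Hν h x0 μ ν
      (fun k => if (k : ℕ) = 0 then 0 else lam k)
      (fun k => if (k : ℕ) = 0 then pi 0 + Cᵀ.mulVec (lam ⟨0, hK⟩) else pi k) ∧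
    (fun k : Fin K => if (k : ℕ) = 0 then 0 else lam k) ⟨0, hK⟩ = (0 : Fin n_c → ℝ) := by
  obtain ⟨K, rfl⟩ : ∃ n, K = n + 1 := ⟨K - 1, by omega⟩
  obtain ⟨hnonneg, hadj, hinput, hterm, hneg⟩ := hcert
  obtain ⟨u, hu⟩ := hsat
  rw [Fin.zero_eta] at hμ0 hu
  have hD : Dᵀ *ᵥ lam 0 = 0 :=
    mulVec_transpose_eq_zero_of_disjoint_columns hdisj (hinput 0)
  refine ⟨⟨fun k i => ?_, fun k => ?_, fun k => ?_, ?_, ?_⟩, by simp⟩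
  · dsimp only
    split_ifs
    · simp
    · exact hnonneg k i
  · refine Fin.cases ?_ (fun j => ?_) k
    · simpa using hadj 0
    · simpa using hadj j.succ
  · refine Fin.cases ?_ (fun j => ?_) k
    · simpa [hD] using hinput 0
    · simpa using hinput j.succ
  · simpa using hterm
  · have hslack := dotProduct_transpose_mulVec_le hu (hnonneg 0) hD
    simp only [Fin.sum_univ_succ (n := K), hμ0, mulVec_zero, sub_zero, zero_dotProduct] at hneg
    simp only [Fin.sum_univ_succ (n := K), hμ0, mulVec_zero, sub_zero, zero_dotProduct,
      Fin.zero_eta, Fin.val_zero, Fin.val_succ, if_true, Nat.succ_ne_zero, if_false,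
      dotProduct_zero, dotProduct_add]
    linarith
end

section
/- Invariance of the Farkas inequality value under joint shifting. For sequences (π, λ, μ, ν) define Φ(π, λ, μ, ν) = x₀ᵀπ[0] + Σ_{k=0}^{K−1} (G_μ μ[k])ᵀ π[k+1] + Σ_{k=0}^{K−1} (h − H_μ μ[k] − H_ν ν[k])ᵀ λ[k]. Let λ[0],…,λ[K−1] ∈ ℝ^{n_c} and π[0],…,π[K] ∈ ℝ^{n_x} satisfy λ[0] = 0 and Aᵀπ[1] = π[0] + Cᵀλ[0], and suppose x₀ = A x₀. Let ν̂ ∈ ({0,1}^{n_ν})^K, w ∈ {0,1}^{n_ν}, and μ ∈ ({0,1}^{n_μ})^K be arbitrary, and define the inverse-shifted sequence ⁱμ = (0, μ[0], …, μ[K−2]) and the shifted sequence ˢν̂ = (ν̂[1], …, ν̂[K−1], w), together with the shifted certificates ˢλ[k] = λ[k+1] for 0 ≤ k ≤ K−2, ˢλ[K−1] = 0, ˢπ[k] = π[k+1] for 0 ≤ k ≤ K−1, ˢπ[K] = 0. Then Φ(ˢπ, ˢλ, μ, ˢν̂) = Φ(π, λ, ⁱμ, ν̂). In particular, if Φ(π,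 λ, ⁱμ, ν̂) < 0 then Φ(ˢπ, ˢλ, μ, ˢν̂) < 0. -/
open Matrix

/-- The Farkas inequality value
`Φ(π, λ, μ, ν) = x₀ᵀπ[0] + Σ_{k} (G_μ μ[k])ᵀ π[k+1] + Σ_{k} (h − H_μ μ[k] − H_ν ν[k])ᵀ λ[k]`. -/
def Phi (K n_x nμ nν n_c : ℕ)
    (Gμ : Matrix (Fin n_x) (Fin nμ) ℝ)
    (Hμ : Matrix (Fin n_c) (Fin nμ) ℝ) (Hν : Matrix (Fin n_c) (Fin nν) ℝ)
    (h : Fin n_c → ℝ) (x0 : Fin n_x → ℝ)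
    (pi : Fin (K + 1) → Fin n_x → ℝ) (lam : Fin K → Fin n_c → ℝ)
    (μ : Fin K → Fin nμ → ℝ) (ν : Fin K → Fin nν → ℝ) : ℝ :=
  x0 ⬝ᵥ pi 0 + (∑ k : Fin K, Gμ.mulVec (μ k) ⬝ᵥ pi k.succ)
    + (∑ k : Fin K, (h - Hμ.mulVec (μ k) - Hν.mulVec (ν k)) ⬝ᵥ lam k)

/-- **Invariance of the Farkas inequality value under joint shifting.** Given `λ[0] = 0`,
the `k = 0` dual dynamics equation `Aᵀπ[1] = π[0] + Cᵀλ[0]`, and stationarity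
`A x₀ = x₀`, the value `Φ` on the shifted certificates `(ˢπ, ˢλ)`, the original binaries
`μ`, and the shifted sequence `ˢν̂ = (ν̂[1], …, ν̂[K-1], w)` equals the value of `Φ` on the
original certificates `(π, λ)`, the inverse-shifted binaries `ⁱμ = (0, μ[0], …, μ[K-2])`,
and `ν̂`. In particular negativity is preserved. -/
theorem phi_invariant_under_joint_shifting
    (K n_x nμ nν n_c : ℕ) (hK : 0 < K)
    (A : Matrix (Fin n_x) (Fin n_x) ℝ)
    (Gμ : Matrix (Fin n_x) (Fin nμ) ℝ)
    (C : Matrix (Fin n_c) (Fin n_x) ℝ)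
    (Hμ : Matrix (Fin n_c) (Fin nμ) ℝ) (Hν : Matrix (Fin n_c) (Fin nν) ℝ)
    (h : Fin n_c → ℝ) (x0 : Fin n_x → ℝ)
    (lam : Fin K → Fin n_c → ℝ) (pi : Fin (K + 1) → Fin n_x → ℝ)
    (hlam0 : lam ⟨0, hK⟩ = 0)
    (hb0 : Aᵀ.mulVec (pi ⟨1, by omega⟩) = pi 0 + Cᵀ.mulVec (lam ⟨0, hK⟩))
    (hstat : A.mulVec x0 = x0)
    (νhat : Fin K → Fin nν → ℝ) (hνbin : ∀ k, IsBinaryVec (νhat k))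
    (w : Fin nν → ℝ) (hw : IsBinaryVec w)
    (μ : Fin K → Fin nμ → ℝ) (hμbin : ∀ k, IsBinaryVec (μ k)) :
    Phi K n_x nμ nν n_c Gμ Hμ Hν h x0
      -- shifted certificate ˢπ
      (fun k : Fin (K + 1) => if hk : (k : ℕ) < K then pi ⟨(k : ℕ) + 1, by omega⟩ else 0)
      -- shifted certificate ˢλ
      (fun k : Fin K => if hk : (k : ℕ) + 1 < K then lam ⟨(k : ℕ) + 1, hk⟩ else 0)
      μ
      -- shifted binary sequence ˢν̂
      (fun k : Fin K => if hk : (k : ℕ) + 1 < K then νhat ⟨(k : ℕ) + 1, hk⟩ else w) =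
    Phi K n_x nμ nν n_c Gμ Hμ Hν h x0 pi lam
      -- inverse-shifted binary sequence ⁱμ
      (fun k : Fin K => if hk : (k : ℕ) = 0 then 0
        else μ ⟨(k : ℕ) - 1, by have := k.isLt; omega⟩)
      νhat ∧
    (Phi K n_x nμ nν n_c Gμ Hμ Hν h x0 pi lam
        (fun k : Fin K => if hk : (k : ℕ) = 0 then 0
          else μ ⟨(k : ℕ) - 1, by have := k.isLt; omega⟩)
        νhat < 0 →
      Phi K n_x nμ nν n_c Gμ Hμ Hν h x0
        (fun k : Fin (K + 1) => if hk : (k : ℕ) < K then pi ⟨(k : ℕ) + 1, by omega⟩ else 0)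
        (fun k : Fin K => if hk : (k : ℕ) + 1 < K then lam ⟨(k : ℕ) + 1, hk⟩ else 0)
        μ
        (fun k : Fin K => if hk : (k : ℕ) + 1 < K then νhat ⟨(k : ℕ) + 1, hk⟩ else w) < 0) := by
  obtain ⟨n, rfl⟩ : ∃ n, K = n + 1 := ⟨K - 1, by omega⟩
  refine and_iff_left_of_imp (fun e hneg => e.trans_lt hneg) |>.mpr ?_
  have hinit : x0 ⬝ᵥ pi 0 = x0 ⬝ᵥ pi 1 := by
    have hpi : pi 0 = Aᵀ *ᵥ pi 1 := by
      have hA := hb0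
      rw [hlam0, mulVec_zero, add_zero] at hA
      exact hA.symm
    rw [hpi, dotProduct_mulVec, vecMul_transpose, hstat]
  have hlam0' : lam 0 = 0 := hlam0
  have hG : ∑ k : Fin (n + 1), Gμ *ᵥ μ k ⬝ᵥ
      (if hk : (k.succ : ℕ) < n + 1 then pi ⟨(k.succ : ℕ) + 1, by omega⟩ else 0) =
      ∑ k : Fin (n + 1), Gμ *ᵥ (if hk : (k : ℕ) = 0 then 0
        else μ ⟨(k : ℕ) - 1, by have := k.isLt; omega⟩) ⬝ᵥ pi k.succ := by
    rw [Fin.sum_univ_castSucc, Fin.sum_univ_succ]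
    simp
    rfl
  have hC : ∑ k : Fin (n + 1), (h - Hμ *ᵥ μ k - Hν *ᵥ
        (if hk : (k : ℕ) + 1 < n + 1 then νhat ⟨(k : ℕ) + 1, hk⟩ else w)) ⬝ᵥ
      (if hk : (k : ℕ) + 1 < n + 1 then lam ⟨(k : ℕ) + 1, hk⟩ else 0) =
      ∑ k : Fin (n + 1), (h - Hμ *ᵥ (if hk : (k : ℕ) = 0 then 0
        else μ ⟨(k : ℕ) - 1, by have := k.isLt; omega⟩) - Hν *ᵥ νhat k) ⬝ᵥ lam k := by
    rw [Fin.sum_univ_castSucc, Fin.sum_univ_succ]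
    simp [hlam0']
    rfl
  have hPhi0 : x0 ⬝ᵥ (if hk : ((0 : Fin (n + 1 + 1)) : ℕ) < n + 1 then
      pi ⟨((0 : Fin (n + 1 + 1)) : ℕ) + 1, by omega⟩ else 0) = x0 ⬝ᵥ pi 0 := by
    rw [hinit, dif_pos (by simp)]
    rfl
  unfold Phi
  rw [hPhi0, hG, hC]
end
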